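/- Let p be an odd prime, f ≥ 1, q = p^f, and d = q + 1. Let k be an algebraically closed field of characteristic p (e.g., an algebraic closure of 𝔽_p), let ζ ∈ k be a primitive d-th root of unity, and let K_d = k(u). Let E be the elliptic curve over K_d defined by y² + xy + u^d y = x³ + u^d x², and for 0 ≤ i ≤ d − 1 let P_i = P(ζ^i u) ∈ E(K_d), where P(u) = (u^q(u^q − u)/(1 + 4u)^q, u^{2q}(1 + 2u + 2u^q)/(2(1 + 4u)^{(3q−1)/2}) − u^{2q}/(2(1 + 4u)^{q−1})). Then the two points Σ_{i=0}^{d−1} P_i and Σ_{i=0}^{d−1} (−1)^i P_i of E(K_d) have finite order. -/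

import Mathlib

/-- The `x`-coordinate of Ulmer's explicit point `P(v)` on `y² + xy + ty = x³ + tx²`,
namely `v^q (v^q − v) / (1 + 4v)^q`. -/
def ulmerX {K : Type*} [Field K] (q : ℕ) (v : K) : K :=
  v ^ q * (v ^ q - v) / (1 + 4 * v) ^ q

/-- The `y`-coordinate of Ulmer's explicit point `P(v)`, namely
`v^{2q}(1 + 2v + 2v^q) / (2(1 + 4v)^{(3q−1)/2}) − v^{2q} / (2(1 + 4v)^{q−1})`. -/
def ulmerY {K : Type*} [Field K] (q : ℕ) (v : K) : K :=
  v ^ (2 * q) * (1 + 2 * v + 2 * v ^ q) / (2 * (1 + 4 * v) ^ ((3 * q - 1) / 2))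
    - v ^ (2 * q) / (2 * (1 + 4 * v) ^ (q - 1))
open Polynomial in
theorem ulmer_mem_XYIdeal {F : Type*} [Field F] (W : WeierstrassCurve.Affine F) (x y : F)
    (g : F[X][X]) (hg : (g.eval (C y)).eval x = 0) :
    WeierstrassCurve.Affine.CoordinateRing.mk W g ∈
      WeierstrassCurve.Affine.CoordinateRing.XYIdeal W x (C y) := by
  have h := (mem_span_C_X_sub_C_X_sub_C_iff_eval_eval_eq_zero (a := x) (b := C y) (P := g)).mpr hg
  have h2 := Ideal.mem_map_of_mem (WeierstrassCurve.Affine.CoordinateRing.mk W) h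
  rw [Ideal.map_span, Set.image_pair] at h2
  exact h2

open Polynomial in
theorem ulmer_mem_prod {F : Type*} [Field F] (W : WeierstrassCurve.Affine F)
    {ι : Type*} [Fintype ι] (x y : ι → F) (hx : Function.Injective x)
    (g : F[X][X]) (hg : ∀ i, (g.eval (C (y i))).eval (x i) = 0) :
    WeierstrassCurve.Affine.CoordinateRing.mk W g ∈
      ∏ i, WeierstrassCurve.Affine.CoordinateRing.XYIdeal W (x i) (C (y i)) := by
  rw [Ideal.prod_eq_iInf_of_pairwise_isCoprime]
  · simp only [Ideal.mem_iInf]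
    intro i _
    exact ulmer_mem_XYIdeal W _ _ g (hg i)
  · intro i _ j _ hij
    have hne : x i - x j ≠ 0 := sub_ne_zero.mpr (hx.ne hij)
    change IsCoprime _ _
    rw [Ideal.isCoprime_iff_exists]
    refine ⟨WeierstrassCurve.Affine.CoordinateRing.mk W (C (C (-(x i - x j)⁻¹) * (X - C (x i)))), ?_,
      WeierstrassCurve.Affine.CoordinateRing.mk W (C (C ((x i - x j)⁻¹) * (X - C (x j)))), ?_, ?_⟩
    · exact ulmer_mem_XYIdeal W _ _ _ (by simp)
    · exact ulmer_mem_XYIdeal W _ _ _ (by simp)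
    · rw [← map_add, ← map_one (WeierstrassCurve.Affine.CoordinateRing.mk W), ← C_add]
      congr 1
      rw [← C_1]
      congr 1
      have : (C (-(x i - x j)⁻¹) * (X - C (x i)) + C (x i - x j)⁻¹ * (X - C (x j)) : F[X])
        = C ((x i - x j)⁻¹ * (x i - x j)) := by
        simp only [C_mul, C_neg, C_sub]; ring
      rw [this, inv_mul_cancel₀ hne, C_1]

open Polynomial in
theorem ulmer_sum_eq_zero {F : Type*} [Field F] [DecidableEq F] (W : WeierstrassCurve.Affine F)
    {ι : Type*} [Fintype ι] (x y : ι → F) (h : ∀ i, W.Nonsingular (x i) (y i))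
    (hx : Function.Injective x) (A B N : F[X])
    (hv : ∀ i, A.eval (x i) + B.eval (x i) * (2 * y i + W.a₁ * x i + W.a₃) = 0)
    (hN : N = A ^ 2 - B ^ 2 * (4 * X ^ 3 + C W.b₂ * X ^ 2 + 2 * C W.b₄ * X + C W.b₆))
    (hN0 : N ≠ 0) (hdeg : N.natDegree ≤ Fintype.card ι) :
    ∑ i, WeierstrassCurve.Affine.Point.some _ _ (h i) = 0 := by
  have hroot : ∀ i, N.eval (x i) = 0 := by
    intro i
    have he := (W.equation_iff _ _).mp (h i).1
    have hvi := hv i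
    rw [hN]
    simp only [eval_sub, eval_mul, eval_add, eval_pow, eval_X, eval_C, eval_ofNat,
      WeierstrassCurve.b₂, WeierstrassCurve.b₄, WeierstrassCurve.b₆]
    linear_combination (A.eval (x i) - B.eval (x i) * (2 * y i + W.a₁ * x i + W.a₃)) * hvi
      + 4 * (B.eval (x i)) ^ 2 * he
  have hdvd : (∏ i, (X - C (x i))) ∣ N := by
    apply Finset.prod_dvd_of_coprime
    · intro i _ j _ hij
      exact pairwise_coprime_X_sub_C hx hij
    · intro i _
      exact dvd_iff_isRoot.mpr (hroot i)
  obtain ⟨c, hc⟩ := hdvd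
  have hc0 : c ≠ 0 := by rintro rfl; simp at hc; exact hN0 hc
  have hcd : c.natDegree = 0 := by
    have h1 : (∏ i, (X - C (x i))).natDegree = Fintype.card ι := by
      rw [natDegree_prod_of_monic _ _ (fun i _ => monic_X_sub_C _)]
      simp
    have h2 := natDegree_mul (p := ∏ i, (X - C (x i))) (q := c)
      (Finset.prod_ne_zero_iff.mpr fun i _ => X_sub_C_ne_zero _) hc0
    rw [← hc, h1] at h2
    omega
  have hcu : IsUnit c := isUnit_iff_degree_eq_zero.mpr (by
    rw [degree_eq_natDegree hc0, hcd]; rfl)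
  set mk := WeierstrassCurve.Affine.CoordinateRing.mk W with hmk
  set L : F[X][X] := 2 * X + C (C W.a₁ * X + C W.a₃) with hL
  set g : F[X][X] := C A + C B * L with hg
  set g' : F[X][X] := C A - C B * L with hg'
  have hgg : mk g * mk g' = mk (C N) := by
    rw [← map_mul]
    apply AdjoinRoot.mk_eq_mk.mpr
    refine ⟨- 4 * C B ^ 2, ?_⟩
    rw [hN, hg, hg', hL, WeierstrassCurve.Affine.polynomial, WeierstrassCurve.b₂,
      WeierstrassCurve.b₄, WeierstrassCurve.b₆]
    simp only [map_ofNat, C_add, C_sub, C_mul, C_pow]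
    ring
  have hmkN : mk (C N) ≠ 0 :=
    AdjoinRoot.mk_ne_zero_of_natDegree_lt WeierstrassCurve.Affine.monic_polynomial
      (C_ne_zero.mpr hN0) (by
        rw [WeierstrassCurve.Affine.natDegree_polynomial, natDegree_C]; norm_num)
  have hg0 : mk g ≠ 0 := fun h0 => hmkN (by rw [← hgg, h0, zero_mul])
  have hg'0 : mk g' ≠ 0 := fun h0 => hmkN (by rw [← hgg, h0, mul_zero])
  have hP : mk g ∈ ∏ i, WeierstrassCurve.Affine.CoordinateRing.XYIdeal W (x i) (C (y i)) := by
    apply ulmer_mem_prod W x y hx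
    intro i
    rw [← hv i]
    simp only [hg, hL, eval_add, eval_mul, eval_C, eval_X, eval_ofNat]
    ring
  have hP' : mk g' ∈ ∏ i, WeierstrassCurve.Affine.CoordinateRing.XYIdeal W (x i)
      (C (W.negY (x i) (y i))) := by
    apply ulmer_mem_prod W x (fun i => W.negY (x i) (y i)) hx
    intro i
    rw [← hv i]
    simp only [hg', hL, WeierstrassCurve.Affine.negY, eval_add, eval_sub, eval_mul, eval_C, eval_X,
      eval_ofNat]
    ring
  have hPP : (∏ i, WeierstrassCurve.Affine.CoordinateRing.XYIdeal W (x i)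
      (C (W.negY (x i) (y i)))) *
      (∏ i, WeierstrassCurve.Affine.CoordinateRing.XYIdeal W (x i) (C (y i))) =
      Ideal.span {mk g * mk g'} := by
    rw [← Finset.prod_mul_distrib]
    simp_rw [WeierstrassCurve.Affine.CoordinateRing.XYIdeal_neg_mul (h _),
      WeierstrassCurve.Affine.CoordinateRing.XIdeal]
    rw [Ideal.prod_span_singleton, hgg, hc, C_mul, map_mul]
    rw [Ideal.span_singleton_mul_right_unit ((hcu.map C).map mk)]
    simp only [WeierstrassCurve.Affine.CoordinateRing.XClass]
    rw [← map_prod, ← map_prod]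
  have hmain : (∏ i, WeierstrassCurve.Affine.CoordinateRing.XYIdeal W (x i) (C (y i))) =
      Ideal.span {mk g} := by
    apply le_antisymm
    · intro a ha
      have h1 : mk g' * a ∈ Ideal.span {mk g * mk g'} := by
        rw [← hPP]; exact Ideal.mul_mem_mul hP' ha
      obtain ⟨b, hb⟩ := Ideal.mem_span_singleton'.mp h1
      refine Ideal.mem_span_singleton'.mpr ⟨b, ?_⟩
      apply mul_left_cancel₀ hg'0
      rw [← hb]; ring
    · rw [Ideal.span_singleton_le_iff_mem]; exact hP
  rw [← WeierstrassCurve.Affine.Point.toClass_eq_zero, map_sum]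
  simp_rw [WeierstrassCurve.Affine.Point.toClass_some]
  have key : ClassGroup.mk W.FunctionField
      (∏ i, WeierstrassCurve.Affine.CoordinateRing.XYIdeal' (W := W) (h i)) = 1 := by
    refine (ClassGroup.mk_eq_one_of_coe_ideal (I' := ∏ i,
      WeierstrassCurve.Affine.CoordinateRing.XYIdeal W (x i) (C (y i))) ?_).mpr ⟨_, hg0, hmain⟩
    rw [Units.coe_prod]
    simp_rw [WeierstrassCurve.Affine.CoordinateRing.XYIdeal'_eq]
    exact (map_prod (FractionalIdeal.coeIdealHom _ _) _ _).symm
  rw [map_prod] at key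
  exact key

/-- linear recurrence of order two -/
def ulmerRec {R : Type*} [CommRing R] (S P a b : R) : ℕ → R
  | 0 => a
  | 1 => b
  | (j + 2) => S * ulmerRec S P a b (j + 1) - P * ulmerRec S P a b j

theorem ulmerRec_map {R T : Type*} [CommRing R] [CommRing T] (φ : R →+* T) (S P a b : R) (j : ℕ) :
    φ (ulmerRec S P a b j) = ulmerRec (φ S) (φ P) (φ a) (φ b) j := by
  induction j using Nat.twoStepInduction with
  | zero => rfl
  | one => rfl
  | more j h0 h1 => simp only [ulmerRec, map_sub, map_mul, h0, h1]

theorem ulmerRec_eq {R : Type*} [CommRing R] (S P a b K A B α β : R) (hS : S = α + β)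
    (hP : P = α * β) (ha : K * a = A + B) (hb : K * b = A * α + B * β) (j : ℕ) :
    K * ulmerRec S P a b j = A * α ^ j + B * β ^ j := by
  induction j using Nat.twoStepInduction with
  | zero => simpa [ulmerRec] using ha
  | one => simpa [ulmerRec] using hb
  | more j h0 h1 =>
    simp only [ulmerRec]
    rw [hS, hP] at *
    linear_combination (α + β) * h1 - α * β * h0

open Polynomial in
theorem ulmerRec_natDegree {F : Type*} [Field F] (S P a b : F[X]) (hS : S.natDegree ≤ 1)
    (hP : P.natDegree ≤ 2) (ha : a.natDegree ≤ 0) (hb : b.natDegree ≤ 1) (j : ℕ) :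
    (ulmerRec S P a b j).natDegree ≤ j := by
  induction j using Nat.twoStepInduction with
  | zero => exact ha
  | one => exact hb
  | more j h0 h1 =>
    simp only [ulmerRec]
    refine (natDegree_sub_le _ _).trans (max_le ?_ ?_)
    · exact natDegree_mul_le.trans (by omega)
    · exact natDegree_mul_le.trans (by omega)

theorem ulmer_coords {F : Type*} [Field F] (q n : ℕ) (v t : F) (hq : q = 2 * n + 1)
    (h2 : (2 : F) ≠ 0) (hz0 : 1 + 4 * v ≠ 0) (hz : (1 + 4 * v) ^ q = 1 + 4 * v ^ q)
    (ht : v ^ (q + 1) = t) :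
    ulmerX q v + t = (v ^ q) ^ 2 / ((1 + 4 * v) ^ n) ^ 2 ∧
    2 * ulmerY q v + ulmerX q v + t =
      (v ^ q) ^ 2 * (((1 + 4 * v) ^ n) ^ 2 + 1) / (2 * ((1 + 4 * v) ^ n) ^ 3) := by
  have e1 : (3 * q - 1) / 2 = 3 * n + 1 := by omega
  have e2 : q - 1 = 2 * n := by omega
  have hw0 : (1 + 4 * v) ^ n ≠ 0 := pow_ne_zero _ hz0
  have hw : ((1 + 4 * v) ^ n) ^ 2 * (1 + 4 * v) = 1 + 4 * v ^ q := by
    rw [← hz, hq]; ring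
  have ht' : t = v * v ^ q := by rw [← ht]; ring
  unfold ulmerX ulmerY
  rw [e1, e2, hz, ← hw, ht']
  have e3 : v ^ (2 * q) = (v ^ q) ^ 2 := by ring
  have e4 : (1 + 4 * v) ^ (3 * n + 1) = ((1 + 4 * v) ^ n) ^ 3 * (1 + 4 * v) := by ring
  have e5 : (1 + 4 * v) ^ (2 * n) = ((1 + 4 * v) ^ n) ^ 2 := by ring
  rw [e3, e4, e5]
  generalize v ^ q = b at *
  generalize (1 + 4 * v) ^ n = w at *
  generalize hzz : 1 + 4 * v = z at *
  constructor
  · field_simp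
    linear_combination (b * v) * hw + b ^ 2 * hzz
  · field_simp
    linear_combination (2 * b * v * w - b ^ 2) * hw + (2 * b ^ 2 * w + b ^ 2) * hzz

theorem ulmer_vanish1 {F : Type*} [Field F] (n : ℕ) (v b w t X Y : F)
    (h2 : (2 : F) ≠ 0) (hw0 : w ≠ 0) (hb0 : b ≠ 0) (hw : (1 + 4 * v) ^ n = w)
    (hz : w ^ 2 * (1 + 4 * v) = 1 + 4 * b) (ht : t = v * b)
    (hX : X = b ^ 2 / w ^ 2) (hY : Y = b ^ 2 * (w ^ 2 + 1) / (2 * w ^ 3)) :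
    X ^ (n + 1) * (1 + (1 - 16 * t) ^ n) - 2 * ulmerRec ((2 - 16 * t) * X + 16 * t ^ 2)
      ((1 - 16 * t) * X ^ 2) 1 ((1 - 16 * t) * X + 16 * t ^ 2) n * Y = 0 := by
  have hc : 1 - 16 * t = (1 + 4 * v) * (1 - 4 * v * w ^ 2) := by
    rw [ht]; linear_combination 4 * v * hz
  have hXw : X * w ^ 2 = b ^ 2 := by rw [hX]; field_simp
  have key := ulmerRec_eq ((2 - 16 * t) * X + 16 * t ^ 2)
      ((1 - 16 * t) * X ^ 2) 1 ((1 - 16 * t) * X + 16 * t ^ 2) (w + w⁻¹) w⁻¹ w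
      (X * (1 + 4 * v)) (X * (1 - 4 * v * w ^ 2))
      (by rw [hX, ht]; field_simp; linear_combination (4 * v) * hz)
      (by rw [hc]; ring) (by ring)
      (by rw [hX, ht]; field_simp
          linear_combination (4 * v * (1 + w ^ 2)) * hz) n
  have hY' : 2 * Y = X * (w + w⁻¹) := by rw [hY, hX]; field_simp
  have e : w⁻¹ * (X * (1 + 4 * v)) ^ n + w * (X * (1 - 4 * v * w ^ 2)) ^ n =
      X ^ n * (1 + (1 - 16 * t) ^ n) := by
    rw [hc, mul_pow, mul_pow, mul_pow, hw]; field_simp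
  rw [e] at key
  linear_combination (-X) * key - ulmerRec ((2 - 16 * t) * X + 16 * t ^ 2)
      ((1 - 16 * t) * X ^ 2) 1 ((1 - 16 * t) * X + 16 * t ^ 2) n * hY'

theorem ulmer_vanish2 {F : Type*} [Field F] (n : ℕ) (v b w t X Y : F)
    (h2 : (2 : F) ≠ 0) (hw0 : w ≠ 0) (hb0 : b ≠ 0) (hv0 : v ≠ 0)
    (hw : (1 + 4 * v) ^ (n + 1) = w)
    (hz : w ^ 2 * (1 + 4 * v) = 1 + 4 * b) (ht : t = v * b)
    (hX : X = b ^ 2 / w ^ 2) (hY : Y = b ^ 2 * (w ^ 2 + 1) / (2 * w ^ 3))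
    (h4 : (4 : F) ^ (2 * n + 3) = 4) (hvb : v ^ (2 * n + 3) = b) :
    (-16 * t ^ 2) ^ (n + 2) + 16 * t * (1 - 16 * t) ^ (n + 1) * X ^ (n + 2)
     - 32 * t ^ 2 * (4 * v) ^ (n + 2) * ulmerRec (-16 * t * (X + t))
      (-16 * t ^ 2 * (1 - 16 * t) * X) 1 (-16 * t * (X + t)) n * Y = 0 := by
  have hc : 1 - 16 * t = (1 + 4 * v) * (1 - 4 * v * w ^ 2) := by
    rw [ht]; linear_combination 4 * v * hz
  have hXw : X * w ^ 2 = b ^ 2 := by rw [hX]; field_simp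
  have hS : -16 * t * (X + t) =
      (X * (4 * v) * (1 - 4 * v * w ^ 2)) + -(X * (4 * v) * w ^ 2 * (1 + 4 * v)) := by
    rw [hX, ht]; field_simp; linear_combination (4 : F) * hz
  have key := ulmerRec_eq (-16 * t * (X + t))
      (-16 * t ^ 2 * (1 - 16 * t) * X) 1 (-16 * t * (X + t))
      (X * (4 * v) * (1 + w ^ 2)) (X * (4 * v) * (1 - 4 * v * w ^ 2))
      (X * (4 * v) * w ^ 2 * (1 + 4 * v))
      (X * (4 * v) * (1 - 4 * v * w ^ 2)) (-(X * (4 * v) * w ^ 2 * (1 + 4 * v)))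
      hS
      (by rw [hc, ht]; linear_combination (16 * X * v ^ 2 * (1 + 4 * v) * (1 - 4 * v * w ^ 2)) * hXw)
      (by ring) (by rw [hS]; ring) n
  set V := ulmerRec (-16 * t * (X + t))
      (-16 * t ^ 2 * (1 - 16 * t) * X) 1 (-16 * t * (X + t)) n with hV
  have hY' : 2 * Y * w = X * (1 + w ^ 2) := by rw [hY, hX]; field_simp; ring
  have h16 : (16 : F) ^ (n + 2) = 16 := by
    have : (16 : F) ^ (n + 2) = 4 ^ (2 * n + 3) * 4 := by
      rw [← pow_succ, show 2 * n + 3 + 1 = 2 * (n + 2) by ring, pow_mul]; norm_num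
    rw [this, h4]; norm_num
  have hb2 : (b ^ 2) ^ (n + 1) * v ^ 2 * b ^ 2 * t = (t ^ 2) ^ (n + 2) * v ^ 2 := by
    rw [ht, mul_pow, mul_pow, show v ^ (2 : ℕ) = v ^ 2 from rfl]
    have : (v ^ 2) ^ (n + 2) = v * b := by rw [← hvb]; ring
    rw [this]; ring
  have h4v : (4 * v) ^ (n + 1) * (4 * v) ^ (n + 1) * v = b := by
    rw [← hvb]
    have : (4 : F) ^ (n + 1) * 4 ^ (n + 1) = 1 := by
      have h40 : (4 : F) ≠ 0 := by
        rw [show (4 : F) = 2 * 2 by norm_num]; exact mul_ne_zero h2 h2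
      apply mul_right_cancel₀ h40
      rw [one_mul]; conv_rhs => rw [← h4]
      ring
    rw [mul_pow]
    linear_combination v ^ (n + 1) * v ^ (n + 1) * v * this
  have hK : X * (4 * v) * (1 + w ^ 2) * V =
      (4 * v) ^ (n + 1) * (X ^ (n + 1) * (1 - 4 * v * w ^ 2) ^ (n + 1)
        - (-1) ^ (n + 1) * (b ^ 2) ^ (n + 1) * w) := by
    have k1 : (-(X * (4 * v) * w ^ 2 * (1 + 4 * v))) ^ (n + 1)
      = (-1) ^ (n + 1) * (b ^ 2) ^ (n + 1) * (4 * v) ^ (n + 1) * w := by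
      rw [← hXw, ← mul_pow, ← mul_pow]
      rw [show -(X * (4 * v) * w ^ 2 * (1 + 4 * v)) = -1 * (X * w ^ 2) * (4 * v) * (1 + 4 * v) by ring,
        mul_pow _ (1 + 4 * v), hw]
    have k2 : (X * (4 * v) * (1 - 4 * v * w ^ 2)) ^ (n + 1) =
      X ^ (n + 1) * (4 * v) ^ (n + 1) * (1 - 4 * v * w ^ 2) ^ (n + 1) := by
      rw [mul_pow, mul_pow]
    rw [pow_succ'] at k1 k2
    linear_combination key + k2 - k1
  have hcw : (1 - 16 * t) ^ (n + 1) = w * (1 - 4 * v * w ^ 2) ^ (n + 1) := by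
    rw [hc, mul_pow, hw]
  have e1 : (-16 * t ^ 2) ^ (n + 2) = (-1) ^ (n + 2) * 16 * (t ^ 2) ^ (n + 2) := by
    rw [← h16, ← mul_pow, ← mul_pow]; congr 1; rw [h16]; ring
  rw [e1, hcw]
  generalize (1 - 4 * v * w ^ 2) ^ (n + 1) = Z at *
  apply mul_right_cancel₀ (mul_ne_zero hw0 (pow_ne_zero 2 hv0))
  rw [zero_mul]
  have e2 : 32 * t ^ 2 * (4 * v) ^ (n + 2) * V * Y * (w * v ^ 2) =
     16 * t ^ 2 * (4 * v) ^ (n + 1) * v ^ 2 * (X * (4 * v) * (1 + w ^ 2) * V) := by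
    linear_combination 16 * t ^ 2 * (4 * v) ^ (n + 2) * V * v ^ 2 * hY'
  linear_combination -e2 - 16 * t ^ 2 * (4 * v) ^ (n + 1) * v ^ 2 * hK
    - 16 * t ^ 2 * v * (X ^ (n + 1) * Z - (-1) ^ (n + 1) * (b ^ 2) ^ (n + 1) * w) * h4v
    + 16 * t * Z * v ^ 2 * X ^ (n + 1) * hXw - (-1) ^ n * 16 * w * hb2
    - (16 * t * Z * X ^ (n + 1) * v * b + (-1) ^ n * 16 * w * (b ^ 2) ^ (n + 1) * t * v * b) * ht

open Polynomial in
theorem ulmer_rel1 {F : Type*} [Field F] [DecidableEq F] (W : WeierstrassCurve.Affine F) (t : F)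
    (hW : W = ⟨1, t, t, 0, 0⟩) (ht0 : t ≠ 0) (h2 : (2 : F) ≠ 0) (n : ℕ)
    {ι : Type*} [Fintype ι] (x y : ι → F) (h : ∀ i, W.Nonsingular (x i) (y i))
    (hx : Function.Injective x) (hcard : Fintype.card ι = 2 * n + 3)
    (hv : ∀ i, (x i + t) ^ (n + 1) * (1 + (1 - 16 * t) ^ n) -
      2 * ulmerRec ((2 - 16 * t) * (x i + t) + 16 * t ^ 2)
      ((1 - 16 * t) * (x i + t) ^ 2) 1 ((1 - 16 * t) * (x i + t) + 16 * t ^ 2) n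
      * (2 * y i + x i + t) = 0) :
    ∑ i, WeierstrassCurve.Affine.Point.some _ _ (h i) = 0 := by
  have h4 : (4 : F) ≠ 0 := by
    rw [show (4 : F) = 2 * 2 by norm_num]; exact mul_ne_zero h2 h2
  have h16 : (16 : F) ≠ 0 := by
    rw [show (16 : F) = 4 * 4 by norm_num]; exact mul_ne_zero h4 h4
  set G : F[X] := ulmerRec (C (2 - 16 * t) * (X + C t) + C (16 * t ^ 2))
      (C (1 - 16 * t) * (X + C t) ^ 2) 1 (C (1 - 16 * t) * (X + C t) + C (16 * t ^ 2)) n with hG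
  have hGe : ∀ a : F, G.eval a = ulmerRec ((2 - 16 * t) * (a + t) + 16 * t ^ 2)
      ((1 - 16 * t) * (a + t) ^ 2) 1 ((1 - 16 * t) * (a + t) + 16 * t ^ 2) n := by
    intro a
    have := ulmerRec_map (evalRingHom a) (C (2 - 16 * t) * (X + C t) + C (16 * t ^ 2))
      (C (1 - 16 * t) * (X + C t) ^ 2) 1 (C (1 - 16 * t) * (X + C t) + C (16 * t ^ 2)) n
    rw [coe_evalRingHom] at this
    rw [hG, this]
    simp only [eval_add, eval_mul, eval_pow, eval_C, eval_X, eval_one]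
  have hGd : G.natDegree ≤ n := by
    apply ulmerRec_natDegree
    · compute_degree
    · compute_degree
    · compute_degree
    · compute_degree
  have hG0 : G.eval (-t) ≠ 0 := by
    rw [hGe]
    have := ulmerRec_eq ((2 - 16 * t) * (-t + t) + 16 * t ^ 2)
      ((1 - 16 * t) * (-t + t) ^ 2) 1 ((1 - 16 * t) * (-t + t) + 16 * t ^ 2) 1 1 0
      (16 * t ^ 2) 0 (by ring) (by ring) (by ring) (by ring) n
    simp only [one_mul, zero_mul, add_zero] at this
    rw [this]
    exact pow_ne_zero _ (mul_ne_zero h16 (pow_ne_zero _ ht0))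
  refine ulmer_sum_eq_zero W x y h hx (C (1 + (1 - 16 * t) ^ n) * (X + C t) ^ (n + 1))
    (-2 * G) _ ?_ rfl ?_ ?_
  · intro i
    rw [← hv i]
    simp only [eval_add, eval_mul, eval_pow, eval_C, eval_X, eval_neg, eval_ofNat, hGe, hW]
    ring
  · have e : (C (1 + (1 - 16 * t) ^ n) * (X + C t) ^ (n + 1)) ^ 2 - (-2 * G) ^ 2 *
        (4 * X ^ 3 + C W.b₂ * X ^ 2 + 2 * C W.b₄ * X + C W.b₆) = (X + C t) *
        (C (1 + (1 - 16 * t) ^ n) ^ 2 * (X + C t) ^ (2 * n + 1) - 4 * G ^ 2 *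
          (4 * X ^ 2 + X + C t)) := by
      simp only [hW, WeierstrassCurve.b₂, WeierstrassCurve.b₄, WeierstrassCurve.b₆]
      simp only [map_ofNat, C_0, C_1, C_add, C_mul, C_pow]
      ring
    rw [e]
    refine mul_ne_zero (X_add_C_ne_zero t) ?_
    intro h0
    have h1 := congrArg (eval (-t)) h0
    simp only [eval_add, eval_sub, eval_mul, eval_pow, eval_C, eval_X, eval_ofNat, eval_zero] at h1
    rw [neg_add_cancel, zero_pow (by omega)] at h1
    have h3 : 4 * 4 * (eval (-t) G) ^ 2 * t ^ 2 = 0 := by linear_combination -h1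
    exact mul_ne_zero (mul_ne_zero (mul_ne_zero h4 h4) (pow_ne_zero _ hG0)) (pow_ne_zero _ ht0) h3
  · rw [hcard]
    refine (natDegree_sub_le _ _).trans (max_le ?_ ?_)
    · have : (C (1 + (1 - 16 * t) ^ n) * (X + C t) ^ (n + 1)).natDegree ≤ n + 1 := by
        compute_degree
      exact natDegree_pow_le.trans (by omega)
    · refine natDegree_mul_le.trans ?_
      have e1 : ((-2 * G) ^ 2).natDegree ≤ 2 * n := by
        refine natDegree_pow_le.trans ?_
        have : (-2 * G).natDegree ≤ n := by
          rw [show (-2 * G : F[X]) = C (-2) * G by rw [C_neg, map_ofNat]]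
          exact (natDegree_C_mul_le _ _).trans hGd
        omega
      have e2 : (4 * X ^ 3 + C W.b₂ * X ^ 2 + 2 * C W.b₄ * X + C W.b₆ : F[X]).natDegree ≤ 3 := by
        compute_degree
      omega

open Polynomial in
theorem ulmer_rel2 {F : Type*} [Field F] [DecidableEq F] (W : WeierstrassCurve.Affine F) (t τ : F)
    (hW : W = ⟨1, t, t, 0, 0⟩) (ht0 : t ≠ 0) (h2 : (2 : F) ≠ 0) (n : ℕ)
    {ι : Type*} [Fintype ι] (x y : ι → F) (h : ∀ i, W.Nonsingular (x i) (y i))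
    (hx : Function.Injective x) (hcard : Fintype.card ι = 2 * n + 4)
    (hv : ∀ i, (-16 * t ^ 2) ^ (n + 2) + 16 * t * (1 - 16 * t) ^ (n + 1) * (x i + t) ^ (n + 2)
     - 32 * t ^ 2 * τ * ulmerRec (-16 * t * ((x i + t) + t))
      (-16 * t ^ 2 * (1 - 16 * t) * (x i + t)) 1 (-16 * t * ((x i + t) + t)) n
      * (2 * y i + x i + t) = 0) :
    ∑ i, WeierstrassCurve.Affine.Point.some _ _ (h i) = 0 := by
  have h4 : (4 : F) ≠ 0 := by
    rw [show (4 : F) = 2 * 2 by norm_num]; exact mul_ne_zero h2 h2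
  have h16 : (16 : F) ≠ 0 := by
    rw [show (16 : F) = 4 * 4 by norm_num]; exact mul_ne_zero h4 h4
  set G : F[X] := ulmerRec (C (-16 * t) * ((X + C t) + C t))
      (C (-16 * t ^ 2 * (1 - 16 * t)) * (X + C t)) 1 (C (-16 * t) * ((X + C t) + C t)) n with hG
  have hGe : ∀ a : F, G.eval a = ulmerRec (-16 * t * ((a + t) + t))
      (-16 * t ^ 2 * (1 - 16 * t) * (a + t)) 1 (-16 * t * ((a + t) + t)) n := by
    intro a
    have := ulmerRec_map (evalRingHom a) (C (-16 * t) * ((X + C t) + C t))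
      (C (-16 * t ^ 2 * (1 - 16 * t)) * (X + C t)) 1 (C (-16 * t) * ((X + C t) + C t)) n
    rw [coe_evalRingHom] at this
    rw [hG, this]
    simp only [eval_add, eval_mul, eval_C, eval_X, eval_one]
  have hGd : G.natDegree ≤ n := by
    apply ulmerRec_natDegree
    · compute_degree
    · refine le_trans (b := 1) ?_ (by norm_num)
      compute_degree
    · compute_degree
    · compute_degree
  refine ulmer_sum_eq_zero W x y h hx (C ((-16 * t ^ 2) ^ (n + 2)) +
    C (16 * t * (1 - 16 * t) ^ (n + 1)) * (X + C t) ^ (n + 2))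
    (C (-32 * t ^ 2 * τ) * G) _ ?_ rfl ?_ ?_
  · intro i
    rw [← hv i]
    simp only [eval_add, eval_mul, eval_pow, eval_C, eval_X, hGe, hW]
    ring
  · intro h0
    have h1 := congrArg (eval (-t)) h0
    simp only [hW, WeierstrassCurve.b₂, WeierstrassCurve.b₄, WeierstrassCurve.b₆] at h1
    simp only [eval_add, eval_sub, eval_mul, eval_pow, eval_C, eval_X, eval_ofNat, eval_zero] at h1
    rw [neg_add_cancel, zero_pow (by omega)] at h1
    have h3 : ((-16 * t ^ 2) ^ (n + 2)) ^ 2 = 0 := by linear_combination h1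
    exact pow_ne_zero _ (pow_ne_zero _ (mul_ne_zero (neg_ne_zero.mpr h16) (pow_ne_zero _ ht0))) h3
  · rw [hcard]
    refine (natDegree_sub_le _ _).trans (max_le ?_ ?_)
    · have : (C ((-16 * t ^ 2) ^ (n + 2)) +
          C (16 * t * (1 - 16 * t) ^ (n + 1)) * (X + C t) ^ (n + 2)).natDegree ≤ n + 2 := by
        compute_degree
      exact natDegree_pow_le.trans (by omega)
    · refine natDegree_mul_le.trans ?_
      have e1 : ((C (-32 * t ^ 2 * τ) * G) ^ 2).natDegree ≤ 2 * n := by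
        refine natDegree_pow_le.trans ?_
        have : (C (-32 * t ^ 2 * τ) * G).natDegree ≤ n := (natDegree_C_mul_le _ _).trans hGd
        omega
      have e2 : (4 * X ^ 3 + C W.b₂ * X ^ 2 + 2 * C W.b₄ * X + C W.b₆ : F[X]).natDegree ≤ 3 := by
        compute_degree
      omega

theorem ulmer_one_add_ne {k : Type*} [Field k] (a : k) :
    (1 + RatFunc.C a * RatFunc.X : RatFunc k) ≠ 0 := by
  have e : (1 + RatFunc.C a * RatFunc.X : RatFunc k) =
      algebraMap (Polynomial k) (RatFunc k) (1 + Polynomial.C a * Polynomial.X) := by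
    simp
  rw [e]
  refine (map_ne_zero_iff _ (RatFunc.algebraMap_injective k)).mpr ?_
  intro h
  have := congrArg (Polynomial.eval 0) h
  simp at this

theorem ulmer_inj {k : Type*} [Field k] (n q : ℕ) (a b : k) (ha : a ≠ 0) (hb : b ≠ 0)
    (h4 : (4 : k) ≠ 0) (hn : n ≠ 0)
    (h : ((RatFunc.C a * RatFunc.X) ^ q) ^ 2 / ((1 + 4 * (RatFunc.C a * RatFunc.X)) ^ n) ^ 2 =
      ((RatFunc.C b * RatFunc.X) ^ q) ^ 2 / ((1 + 4 * (RatFunc.C b * RatFunc.X : RatFunc k)) ^ n) ^ 2) :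
    a = b := by
  have hz : ∀ c : k, (1 + 4 * (RatFunc.C c * RatFunc.X) : RatFunc k) ≠ 0 := by
    intro c
    have := ulmer_one_add_ne (4 * c)
    rw [map_mul, map_ofNat, mul_assoc] at this
    exact this
  rw [div_eq_div_iff (pow_ne_zero _ (pow_ne_zero _ (hz a))) (pow_ne_zero _ (pow_ne_zero _ (hz b)))] at h
  have hX : (RatFunc.X : RatFunc k) ≠ 0 := RatFunc.X_ne_zero
  have h' : (RatFunc.C a ^ q) ^ 2 * ((1 + 4 * (RatFunc.C b * RatFunc.X)) ^ n) ^ 2 =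
    (RatFunc.C b ^ q) ^ 2 * ((1 + 4 * (RatFunc.C a * RatFunc.X : RatFunc k)) ^ n) ^ 2 := by
    apply mul_right_cancel₀ (pow_ne_zero 2 (pow_ne_zero q hX))
    rw [mul_pow, mul_pow] at h
    linear_combination h
  have h3 : (algebraMap (Polynomial k) (RatFunc k)) ((Polynomial.C a ^ q) ^ 2 *
      ((1 + 4 * (Polynomial.C b * Polynomial.X)) ^ n) ^ 2) =
      (algebraMap (Polynomial k) (RatFunc k)) ((Polynomial.C b ^ q) ^ 2 *
      ((1 + 4 * (Polynomial.C a * Polynomial.X)) ^ n) ^ 2) := by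
    simp only [map_mul, map_pow, map_add, map_one, map_ofNat, RatFunc.algebraMap_C,
      RatFunc.algebraMap_X]
    exact h'
  have h4' := congrArg (Polynomial.eval (-(4 * b)⁻¹)) (RatFunc.algebraMap_injective k h3)
  simp only [Polynomial.eval_mul, Polynomial.eval_pow, Polynomial.eval_add, Polynomial.eval_C,
    Polynomial.eval_X, Polynomial.eval_one, Polynomial.eval_ofNat] at h4'
  have e : 1 + 4 * (b * -(4 * b)⁻¹) = 0 := by field_simp; ring
  rw [e, zero_pow hn, zero_pow two_ne_zero, mul_zero] at h4'
  have h5 : 1 + 4 * (a * -(4 * b)⁻¹) = 0 := by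
    have := h4'.symm
    simpa [hb, hn, pow_eq_zero_iff] using this
  field_simp at h5
  linear_combination -h5

open scoped Classical in
/-- Let `p` be an odd prime, `q = p^f`, `d = q + 1`, `k` an algebraically closed field of
characteristic `p`, `ζ ∈ k` a primitive `d`-th root of unity, and `K_d = k(u)`.  Let `E` be the
elliptic curve `y² + xy + u^d y = x³ + u^d x²` over `K_d` and `P_i = P(ζ^i u) ∈ E(K_d)` for
`0 ≤ i ≤ d − 1` the explicit points.  Then `Σ P_i` and `Σ (−1)^i P_i` have finite order
in `E(K_d)`. -/
theorem ulmer_points_relations_torsion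
    (p f q d : ℕ) (hp : p.Prime) (hodd : Odd p) (hf : 1 ≤ f)
    (hq : q = p ^ f) (hd : d = q + 1)
    (k : Type*) [Field k] [IsAlgClosed k] [CharP k p]
    (ζ : k) (hζ : IsPrimitiveRoot ζ d)
    (W : WeierstrassCurve (RatFunc k))
    (hW : W = ⟨1, RatFunc.X ^ d, RatFunc.X ^ d, 0, 0⟩)
    (hns : ∀ i : Fin d, W.toAffine.Nonsingular
      (ulmerX q (RatFunc.C (ζ ^ (i : ℕ)) * RatFunc.X))
      (ulmerY q (RatFunc.C (ζ ^ (i : ℕ)) * RatFunc.X))) :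
    IsOfFinAddOrder (∑ i : Fin d, WeierstrassCurve.Affine.Point.some _ _ (hns i)) ∧
      IsOfFinAddOrder
        (∑ i : Fin d, ((-1 : ℤ) ^ (i : ℕ)) • WeierstrassCurve.Affine.Point.some _ _ (hns i)) := by
  have hp2 : p ≠ 2 := by rintro rfl; exact absurd hodd (by decide)
  have hp3 : 3 ≤ p := by have := hp.two_le; omega
  have hq3 : 3 ≤ q := by
    rw [hq]; exact hp3.trans (Nat.le_self_pow (by omega) p)
  have hqodd : Odd q := by rw [hq]; exact hodd.pow
  obtain ⟨n, hn⟩ : ∃ n, q = 2 * n + 3 := by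
    obtain ⟨m, hm⟩ := hqodd
    exact ⟨m - 1, by omega⟩
  haveI : Fact p.Prime := ⟨hp⟩
  haveI : CharP (RatFunc k) p := charP_of_injective_ringHom (RatFunc.C (K := k)).injective p
  have h2k : (2 : k) ≠ 0 := Ring.two_ne_zero (by rw [ringChar.eq k p]; exact hp2)
  have h4k : (4 : k) ≠ 0 := by
    rw [show (4 : k) = 2 * 2 by norm_num]; exact mul_ne_zero h2k h2k
  have h2 : (2 : RatFunc k) ≠ 0 := Ring.two_ne_zero (by rw [ringChar.eq (RatFunc k) p]; exact hp2)
  have hfrob : ∀ a : RatFunc k, iterateFrobenius (RatFunc k) p f a = a ^ q := by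
    intro a; rw [iterateFrobenius_def, hq]
  have h4q : (4 : RatFunc k) ^ q = 4 := by
    rw [← hfrob, map_ofNat]
  have hζ0 : ζ ≠ 0 := hζ.ne_zero (by omega)
  have hX : (RatFunc.X : RatFunc k) ≠ 0 := RatFunc.X_ne_zero
  set t : RatFunc k := RatFunc.X ^ d with ht
  have ht0 : t ≠ 0 := pow_ne_zero _ hX
  set v : Fin d → RatFunc k := fun i => RatFunc.C (ζ ^ (i : ℕ)) * RatFunc.X with hvdef
  have hv0 : ∀ i, v i ≠ 0 := fun i =>
    mul_ne_zero ((map_ne_zero _).mpr (pow_ne_zero _ hζ0)) hX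
  have hz0 : ∀ i, 1 + 4 * v i ≠ 0 := by
    intro i
    have := ulmer_one_add_ne (4 * ζ ^ (i : ℕ))
    rw [map_mul, map_ofNat, mul_assoc] at this
    exact this
  have hz : ∀ i, (1 + 4 * v i) ^ q = 1 + 4 * v i ^ q := by
    intro i
    rw [← hfrob, map_add, map_mul, map_one, map_ofNat, hfrob]
  have hvt : ∀ i, v i ^ (q + 1) = t := by
    intro i
    rw [hvdef, ht, ← hd]
    simp only
    rw [mul_pow, ← map_pow, ← pow_mul, mul_comm (i : ℕ), pow_mul, hζ.pow_eq_one, one_pow, map_one,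
      one_mul]
  have hco := fun i => ulmer_coords q (n + 1) (v i) t (by omega) h2 (hz0 i) (hz i) (hvt i)
  have hinj : Function.Injective (fun i => ulmerX q (v i)) := by
    intro i j hij
    have h1 := (hco i).1
    have h2' := (hco j).1
    simp only at hij
    rw [hij, h2'] at h1
    have h3 := ulmer_inj (n + 1) q _ _ (pow_ne_zero _ hζ0) (pow_ne_zero _ hζ0) h4k (by omega) h1
    exact Fin.ext (hζ.pow_inj j.2 i.2 h3).symm
  have hw : ∀ i, ((1 + 4 * v i) ^ (n + 1)) ^ 2 * (1 + 4 * v i) = 1 + 4 * v i ^ q := by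
    intro i; rw [← hz i, hn]; ring
  have hvt' : ∀ i, t = v i * v i ^ q := fun i => by rw [← hvt i]; ring
  have hxne : ∀ i, ulmerX q (v i) ≠ -t := by
    intro i h0
    have h1 := (hco i).1
    rw [h0, neg_add_cancel] at h1
    exact div_ne_zero (pow_ne_zero _ (pow_ne_zero _ (hv0 i)))
      (pow_ne_zero _ (pow_ne_zero _ (hz0 i))) h1.symm
  constructor
  · have hT : W.toAffine.Nonsingular (-t) 0 := by
      rw [WeierstrassCurve.Affine.nonsingular_iff, WeierstrassCurve.Affine.equation_iff]
      subst hW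
      refine ⟨by ring, Or.inl ?_⟩
      intro h0
      apply pow_ne_zero 2 ht0
      linear_combination -h0
    have hns' : ∀ o : Option (Fin d), W.toAffine.Nonsingular
        (o.elim (-t) (fun i => ulmerX q (v i))) (o.elim 0 (fun i => ulmerY q (v i))) := by
      rintro (_ | i)
      · exact hT
      · exact hns i
    have hsum := ulmer_rel1 W.toAffine t hW ht0 h2 (n + 1)
      (fun o : Option (Fin d) => o.elim (-t) (fun i => ulmerX q (v i)))
      (fun o => o.elim 0 (fun i => ulmerY q (v i))) hns'
      (by
        rintro (_ | i) (_ | j) hij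
        · rfl
        · exact absurd hij.symm (hxne j)
        · exact absurd hij (hxne i)
        · exact congrArg some (hinj hij))
      (by rw [Fintype.card_option, Fintype.card_fin]; omega)
      (by
        rintro (_ | i)
        · simp
        · exact ulmer_vanish1 (n + 1) (v i) (v i ^ q) ((1 + 4 * v i) ^ (n + 1)) t _ _ h2
            (pow_ne_zero _ (hz0 i)) (pow_ne_zero _ (hv0 i)) rfl (hw i) (hvt' i) (hco i).1 (hco i).2)
    rw [Fintype.sum_option] at hsum
    have hTT : WeierstrassCurve.Affine.Point.some _ _ hT +
        WeierstrassCurve.Affine.Point.some _ _ hT = 0 := by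
      rw [WeierstrassCurve.Affine.Point.add_self_of_Y_eq]
      subst hW
      simp [WeierstrassCurve.Affine.negY]
    have hS : (∑ i : Fin d, WeierstrassCurve.Affine.Point.some _ _ (hns i)) =
        - WeierstrassCurve.Affine.Point.some _ _ hT := (neg_eq_of_add_eq_zero_right hsum).symm
    rw [hS, isOfFinAddOrder_iff_nsmul_eq_zero]
    refine ⟨2, by norm_num, ?_⟩
    rw [two_nsmul, ← neg_add, hTT, neg_zero]
  · have hζh : ζ ^ (n + 2) = -1 := by
      have h1 : ζ ^ (n + 2) * ζ ^ (n + 2) = 1 := by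
        rw [← pow_add, show n + 2 + (n + 2) = d by omega, hζ.pow_eq_one]
      rcases mul_self_eq_one_iff.mp h1 with h | h
      · exact absurd h (hζ.pow_ne_one_of_pos_of_lt (by omega) (by omega))
      · exact h
    have hsgn : ∀ i : Fin d, v i ^ (n + 2) = (-1) ^ (i : ℕ) * RatFunc.X ^ (n + 2) := by
      intro i
      rw [hvdef]
      simp only
      rw [mul_pow, ← map_pow, ← pow_mul, mul_comm (i : ℕ), pow_mul, hζh, map_pow, map_neg, map_one]
    have hnegns : ∀ i, W.toAffine.Nonsingular (ulmerX q (v i))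
        (W.toAffine.negY (ulmerX q (v i)) (ulmerY q (v i))) := fun i =>
      (WeierstrassCurve.Affine.nonsingular_neg ..).mpr (hns i)
    have hns' : ∀ i : Fin d, W.toAffine.Nonsingular (ulmerX q (v i))
        (if Even (i : ℕ) then ulmerY q (v i)
          else W.toAffine.negY (ulmerX q (v i)) (ulmerY q (v i))) := by
      intro i
      split_ifs
      · exact hns i
      · exact hnegns i
    have hsum := ulmer_rel2 W.toAffine t ((4 * RatFunc.X) ^ (n + 2)) hW ht0 h2 n
      (fun i => ulmerX q (v i)) _ hns' hinj (by rw [Fintype.card_fin]; omega)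
      (by
        intro i
        have h1 := ulmer_vanish2 n (v i) (v i ^ q) ((1 + 4 * v i) ^ (n + 1)) t _ _ h2
          (pow_ne_zero _ (hz0 i)) (pow_ne_zero _ (hv0 i)) (hv0 i) rfl (hw i) (hvt' i)
          (hco i).1 (hco i).2 (by rw [← hn]; exact h4q) (by rw [← hn])
        rw [mul_pow 4 (v i), hsgn i] at h1
        rw [mul_pow 4 RatFunc.X]
        rw [← h1]
        split_ifs with he
        · rw [he.neg_one_pow]; ring
        · rw [(Nat.not_even_iff_odd.mp he).neg_one_pow, WeierstrassCurve.Affine.negY]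
          subst hW
          simp only
          ring)
    have hS : (∑ i : Fin d, ((-1 : ℤ) ^ (i : ℕ)) •
        WeierstrassCurve.Affine.Point.some _ _ (hns i)) = 0 := by
      rw [← hsum]
      refine Finset.sum_congr rfl fun i _ => ?_
      by_cases he : Even (i : ℕ)
      · rw [he.neg_one_pow, one_zsmul]
        simp only [he, if_true]
        rfl
      · rw [(Nat.not_even_iff_odd.mp he).neg_one_pow, neg_one_zsmul]
        simp only [he, if_false]
        rfl
    rw [hS]
    exact IsOfFinAddOrder.zero
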